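/- arXiv:2002.04118 — 3 statements merged into one kernel-verified Lean document; each statement's English description precedes it below -/
import Mathlib

section
/- (Mean ASE, sub-linear case; core of Lemma 5 / Theorem 2 for the mean.) Let K > 0 be a constant, a_n > 0 with a_n → 0, and let Z_n : Ω → [0,∞) be integrable random variables such that Z_n → K almost surely and E[Z_n] → K. Then E[(1/a_n)·log₂(1 + a_n·Z_n)] → K/ln 2 as n → ∞. -/
open MeasureTheory Filter Real

lemma div_one_add_mul_le_log_div {a z : ℝ} (ha : 0 < a) (hz : 0 ≤ z) :
    z / (1 + a * z) ≤ Real.log (1 + a * z) / a := by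
  have h : 0 < 1 + a * z := by positivity
  rw [le_div_iff₀ ha]
  refine le_of_eq_of_le ?_ (Real.one_sub_inv_le_log_of_pos h)
  field_simp
  ring

lemma log_one_add_mul_div_le {a z : ℝ} (ha : 0 < a) (hz : 0 ≤ z) :
    Real.log (1 + a * z) / a ≤ z := by
  have h : 0 < 1 + a * z := by positivity
  rw [div_le_iff₀ ha]
  linarith [Real.log_le_sub_one_of_pos h]

/-- Nonnegative random variables converging almost surely to a constant `c` have expectations
converging to `c`, provided they are dominated by random variables with that property. -/
lemma tendsto_integral_of_le_of_tendsto_ae_const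
    {Ω : Type*} [MeasurableSpace Ω] {μ : Measure Ω} [IsProbabilityMeasure μ]
    {c : ℝ} (hc : 0 ≤ c) {f g : ℕ → Ω → ℝ}
    (hf_nonneg : ∀ n ω, 0 ≤ f n ω) (hfg : ∀ n ω, f n ω ≤ g n ω)
    (hf_meas : ∀ n, AEStronglyMeasurable (f n) μ) (hg_int : ∀ n, Integrable (g n) μ)
    (hf : ∀ᵐ ω ∂μ, Tendsto (fun n => f n ω) atTop (nhds c))
    (hg : Tendsto (fun n => ∫ ω, g n ω ∂μ) atTop (nhds c)) :
    Tendsto (fun n => ∫ ω, f n ω ∂μ) atTop (nhds c) := by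
  have hf_int : ∀ n, Integrable (f n) μ := fun n =>
    (hg_int n).mono' (hf_meas n) <| ae_of_all _ fun ω => by
      simpa [abs_of_nonneg (hf_nonneg n ω)] using hfg n ω
  have hmin_int : ∀ n, Integrable (fun ω => min (f n ω) c) μ := fun n =>
    (hf_int n).inf (integrable_const c)
  have hmin : Tendsto (fun n => ∫ ω, min (f n ω) c ∂μ) atTop (nhds c) := by
    have h := tendsto_integral_of_dominated_convergence (μ := μ)
      (F := fun n ω => min (f n ω) c) (f := fun _ => c) (fun _ => c)
      (fun n => (hmin_int n).aestronglyMeasurable) (integrable_const c)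
      (fun n => ae_of_all _ fun ω => by
        simp [abs_of_nonneg (le_min (hf_nonneg n ω) hc)])
      (hf.mono fun ω hω => by simpa using hω.min (tendsto_const_nhds (x := c)))
    simpa using h
  exact tendsto_of_tendsto_of_tendsto_of_le_of_le hmin hg
    (fun n => integral_mono (hmin_int n) (hf_int n) fun ω => min_le_left _ _)
    (fun n => integral_mono (hf_int n) (hg_int n) (hfg n))

/-- Mean ASE, sub-linear case (core of Lemma 5 / Theorem 2 for the mean):
if `a_n → 0`, `Z_n → K` a.s. and `E[Z_n] → K`, then
`E[(1/a_n) · log₂(1 + a_n · Z_n)] → K / ln 2`. -/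
theorem mean_ase_sublinear
    {Ω : Type*} [MeasurableSpace Ω] {μ : Measure Ω} [IsProbabilityMeasure μ]
    (K : ℝ) (hK : 0 < K)
    (a : ℕ → ℝ) (ha_pos : ∀ n, 0 < a n) (ha : Tendsto a atTop (nhds 0))
    (Z : ℕ → Ω → ℝ) (hZ_nonneg : ∀ n ω, 0 ≤ Z n ω)
    (hZ_int : ∀ n, Integrable (Z n) μ)
    (hZ_as : ∀ᵐ ω ∂μ, Tendsto (fun n => Z n ω) atTop (nhds K))
    (hZ_mean : Tendsto (fun n => ∫ ω, Z n ω ∂μ) atTop (nhds K)) :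
    Tendsto (fun n => ∫ ω, (1 / a n) * logb 2 (1 + a n * Z n ω) ∂μ) atTop
      (nhds (K / Real.log 2)) := by
  have hlog : ∀ n ω, (1 / a n) * logb 2 (1 + a n * Z n ω)
      = Real.log (1 + a n * Z n ω) / a n / Real.log 2 := fun n ω => by
    rw [logb]; ring
  simp_rw [hlog, integral_div (Real.log 2)]
  refine Tendsto.div_const ?_ _
  refine tendsto_integral_of_le_of_tendsto_ae_const hK.le
    (fun n ω => ?_) (fun n ω => log_one_add_mul_div_le (ha_pos n) (hZ_nonneg n ω))
    (fun n => ?_) hZ_int ?_ hZ_mean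
  · have := mul_nonneg (ha_pos n).le (hZ_nonneg n ω)
    exact div_nonneg (Real.log_nonneg (by linarith)) (ha_pos n).le
  · have := (hZ_int n).aemeasurable
    exact AEMeasurable.aestronglyMeasurable (by fun_prop)
  · filter_upwards [hZ_as] with ω hω
    refine tendsto_of_tendsto_of_tendsto_of_le_of_le ?_ hω
      (fun n => div_one_add_mul_le_log_div (ha_pos n) (hZ_nonneg n ω))
      (fun n => log_one_add_mul_div_le (ha_pos n) (hZ_nonneg n ω))
    have h := hω.div ((ha.mul hω).const_add 1) (by simp)
    simpa [Pi.div_def] using h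
end

section
/- (Mean ASE, linear case; core of Lemma 5 / Theorem 2 for the mean.) Let K > 0 and a > 0 be constants, a_n > 0 with a_n → a, and let Z_n : Ω → [0,∞) be integrable random variables such that Z_n → K almost surely and E[Z_n] → K. Then E[(1/a_n)·log₂(1 + a_n·Z_n)] → (1/a)·log₂(1 + aK) as n → ∞. -/
open MeasureTheory Filter Real

/-- Scheffé's lemma for a constant limit. -/
lemma tendsto_integral_abs_sub_const_of_nonneg
    {Ω : Type*} [MeasurableSpace Ω] {μ : Measure Ω} [IsProbabilityMeasure μ]
    {K : ℝ} {Z : ℕ → Ω → ℝ} (hZ_nonneg : ∀ n ω, 0 ≤ Z n ω)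
    (hZ_int : ∀ n, Integrable (Z n) μ)
    (hZ_as : ∀ᵐ ω ∂μ, Tendsto (fun n => Z n ω) atTop (nhds K))
    (hZ_mean : Tendsto (fun n => ∫ ω, Z n ω ∂μ) atTop (nhds K)) :
    Tendsto (fun n => ∫ ω, |Z n ω - K| ∂μ) atTop (nhds 0) := by
  have hsub (n : ℕ) : Integrable (fun ω => K - Z n ω) μ := (integrable_const K).sub (hZ_int n)
  have hpos : Tendsto (fun n => ∫ ω, max (K - Z n ω) 0 ∂μ) atTop (nhds 0) := by
    have h := tendsto_integral_of_dominated_convergence (μ := μ)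
      (F := fun n ω => max (K - Z n ω) 0) (f := fun _ => (0 : ℝ)) (fun _ => |K|)
      (fun n => (hsub n).pos_part.aestronglyMeasurable) (integrable_const _)
      (fun n => Eventually.of_forall fun ω => by
        rw [norm_eq_abs, abs_of_nonneg (le_max_right _ _)]
        exact max_le (by linarith [le_abs_self K, hZ_nonneg n ω]) (abs_nonneg K))
      (by
        filter_upwards [hZ_as] with ω hω
        simpa using (hω.const_sub K).max (tendsto_const_nhds (x := (0 : ℝ))))
    simpa using h
  have heq (n : ℕ) : ∫ ω, |Z n ω - K| ∂μ
      = 2 * ∫ ω, max (K - Z n ω) 0 ∂μ + (∫ ω, Z n ω ∂μ - K) := by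
    have hK : ∫ ω, (Z n ω - K) ∂μ = ∫ ω, Z n ω ∂μ - K := by
      rw [integral_sub (hZ_int n) (integrable_const K)]
      simp
    have hsub' : Integrable (fun ω => Z n ω - K) μ := (hZ_int n).sub (integrable_const K)
    rw [← hK, ← integral_const_mul, ← integral_add ((hsub n).pos_part.const_mul 2) hsub']
    refine integral_congr_ae (Eventually.of_forall fun ω => ?_)
    rcases le_total (Z n ω) K with h | h
    · simp only [abs_of_nonpos (sub_nonpos.2 h), max_eq_left (sub_nonneg.2 h)]
      ring
    · simp only [abs_of_nonneg (sub_nonneg.2 h), max_eq_right (sub_nonpos.2 h)]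
      ring
  simp_rw [heq]
  simpa using (hpos.const_mul 2).add (hZ_mean.sub_const K)

lemma logb_one_add_mul_sub_le {b x y : ℝ} (hb : 0 < b) (hx : 0 ≤ x) (hy : 0 ≤ y) :
    (1 / b) * logb 2 (1 + b * x) - (1 / b) * logb 2 (1 + b * y) ≤ |x - y| / log 2 := by
  have hlog2 : 0 < log 2 := log_pos one_lt_two
  have hu : 0 < 1 + b * x := by positivity
  have hv : 0 < 1 + b * y := by positivity
  have h : log (1 + b * x) - log (1 + b * y) ≤ b * |x - y| := by
    rw [← log_div hu.ne' hv.ne']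
    refine (log_le_sub_one_of_pos (div_pos hu hv)).trans ?_
    rw [div_sub_one hv.ne', div_le_iff₀ hv]
    nlinarith [mul_le_mul_of_nonneg_left (le_abs_self (x - y)) hb.le,
      mul_nonneg (mul_nonneg hb.le (abs_nonneg (x - y))) (mul_nonneg hb.le hy)]
  have key : (1 / b) * logb 2 (1 + b * x) - (1 / b) * logb 2 (1 + b * y)
      = (log (1 + b * x) - log (1 + b * y)) / b / log 2 := by
    simp only [logb]
    field_simp
  rw [key]
  gcongr
  rw [div_le_iff₀ hb]
  linarith

lemma abs_logb_one_add_mul_sub_le {b x y : ℝ} (hb : 0 < b) (hx : 0 ≤ x) (hy : 0 ≤ y) :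
    |(1 / b) * logb 2 (1 + b * x) - (1 / b) * logb 2 (1 + b * y)| ≤ |x - y| / log 2 := by
  refine abs_sub_le_iff.2 ⟨logb_one_add_mul_sub_le hb hx hy, ?_⟩
  rw [abs_sub_comm]
  exact logb_one_add_mul_sub_le hb hy hx

/-- Mean ASE, linear case (core of Lemma 5 / Theorem 2 for the mean):
if `a_n → a > 0`, `Z_n → K` a.s. and `E[Z_n] → K`, then
`E[(1/a_n) · log₂(1 + a_n · Z_n)] → (1/a) · log₂(1 + aK)`. -/
theorem mean_ase_linear
    {Ω : Type*} [MeasurableSpace Ω] {μ : Measure Ω} [IsProbabilityMeasure μ]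
    (K a : ℝ) (hK : 0 < K) (ha : 0 < a)
    (an : ℕ → ℝ) (han_pos : ∀ n, 0 < an n) (han : Tendsto an atTop (nhds a))
    (Z : ℕ → Ω → ℝ) (hZ_nonneg : ∀ n ω, 0 ≤ Z n ω)
    (hZ_int : ∀ n, Integrable (Z n) μ)
    (hZ_as : ∀ᵐ ω ∂μ, Tendsto (fun n => Z n ω) atTop (nhds K))
    (hZ_mean : Tendsto (fun n => ∫ ω, Z n ω ∂μ) atTop (nhds K)) :
    Tendsto (fun n => ∫ ω, (1 / an n) * logb 2 (1 + an n * Z n ω) ∂μ) atTop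
      (nhds ((1 / a) * logb 2 (1 + a * K))) := by
  have hlim : Tendsto (fun n => (1 / an n) * logb 2 (1 + an n * K)) atTop
      (nhds ((1 / a) * logb 2 (1 + a * K))) := by
    have hne : 1 + a * K ≠ 0 := by positivity
    refine (tendsto_const_nhds.div han ha.ne').mul ?_
    exact (((han.mul_const K).const_add 1).log hne).div_const _
  have hdiff : Tendsto (fun n => ∫ ω, (1 / an n) * logb 2 (1 + an n * Z n ω) ∂μ
      - (1 / an n) * logb 2 (1 + an n * K)) atTop (nhds 0) := by
    have hScheffe := (tendsto_integral_abs_sub_const_of_nonneg hZ_nonneg hZ_int hZ_as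
      hZ_mean).div_const (log 2)
    rw [zero_div] at hScheffe
    refine squeeze_zero_norm (fun n => ?_) hScheffe
    have hint : Integrable (fun ω => (1 / an n) * logb 2 (1 + an n * Z n ω)) μ := by
      refine ((hZ_int n).abs.div_const (log 2)).mono' ?_ (Eventually.of_forall fun ω => ?_)
      · have hm := (hZ_int n).aestronglyMeasurable.aemeasurable
        exact ((((hm.const_mul (an n)).const_add 1).log.div_const (log 2)).const_mul
          (1 / an n)).aestronglyMeasurable
      · simpa using abs_logb_one_add_mul_sub_le (han_pos n) (hZ_nonneg n ω) le_rfl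
    have hconst : (1 / an n) * logb 2 (1 + an n * K)
        = ∫ _, (1 / an n) * logb 2 (1 + an n * K) ∂μ := by simp
    rw [hconst, ← integral_sub hint (integrable_const _), ← integral_div]
    exact norm_integral_le_of_norm_le (((hZ_int n).sub (integrable_const K)).abs.div_const _)
      (Eventually.of_forall fun ω =>
        abs_logb_one_add_mul_sub_le (han_pos n) (hZ_nonneg n ω) hK.le)
  simpa using hdiff.add hlim
end

section
/- (Mean ASE, super-linear case; core of Lemma 5 / Theorem 2 for the mean.) Let K > 0 be a constant, a_n > 0 with a_n → ∞, and let Z_n : Ω → [0,∞) be integrable random variables such that Z_n → K almost surely and E[Z_n] → K. Then E[log₂(1 + a_n·Z_n)]/log₂(a_n) → 1 as n → ∞. -/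
open MeasureTheory Filter Real

/-- If `a → ∞` and `z → K > 0`, then `log (1 + a z) / log a → 1`. -/
lemma tendsto_log_one_add_mul_div_log {ι : Type*} {l : Filter ι} {a z : ι → ℝ} {K : ℝ}
    (hK : 0 < K) (ha : Tendsto a l atTop) (hz : Tendsto z l (nhds K)) :
    Tendsto (fun i => log (1 + a i * z i) / log (a i)) l (nhds 1) := by
  have hw : Tendsto (fun i => (a i)⁻¹ + z i) l (nhds K) := by
    simpa using (tendsto_inv_atTop_zero.comp ha).add hz
  have hlog : Tendsto (fun i => 1 + log ((a i)⁻¹ + z i) / log (a i)) l (nhds 1) := by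
    simpa using ((hw.log hK.ne').div_atTop (tendsto_log_atTop.comp ha)).const_add 1
  refine hlog.congr' ?_
  filter_upwards [ha.eventually_gt_atTop 1, hw.eventually_const_lt hK] with i hai hwi
  have ha0 : a i ≠ 0 := by positivity
  have hfactor : 1 + a i * z i = a i * ((a i)⁻¹ + z i) := by field_simp
  rw [hfactor, log_mul ha0 hwi.ne', add_div, div_self (log_pos hai).ne']

/-- If `X ≥ 0` is integrable, then so is `log (1 + X)`. -/
lemma integrable_log_one_add {Ω : Type*} [MeasurableSpace Ω] {μ : Measure Ω} {X : Ω → ℝ}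
    (hX : ∀ ω, 0 ≤ X ω) (hX_int : Integrable X μ) :
    Integrable (fun ω => log (1 + X ω)) μ := by
  refine hX_int.mono'
    (measurable_log.comp_aemeasurable (hX_int.aemeasurable.const_add 1)).aestronglyMeasurable
    (Eventually.of_forall fun ω => ?_)
  have h := hX ω
  rw [norm_eq_abs, abs_of_nonneg (log_nonneg (by linarith))]
  linarith [log_le_sub_one_of_pos (show 0 < 1 + X ω by linarith)]

/-- Jensen's inequality for `x ↦ log (1 + x)`. -/
lemma integral_log_one_add_le {Ω : Type*} [MeasurableSpace Ω] {μ : Measure Ω}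
    [IsProbabilityMeasure μ] {X : Ω → ℝ} (hX : ∀ ω, 0 ≤ X ω) (hX_int : Integrable X μ) :
    ∫ ω, log (1 + X ω) ∂μ ≤ log (1 + ∫ ω, X ω ∂μ) := by
  set m := ∫ ω, X ω ∂μ with hm
  have hm0 : 0 < 1 + m := by linarith [show 0 ≤ m from integral_nonneg hX]
  have htangent : ∀ ω, log (1 + X ω) ≤ log (1 + m) + (X ω - m) / (1 + m) := fun ω => by
    have hω : 0 < 1 + X ω := by linarith [hX ω]
    have h := log_le_sub_one_of_pos (div_pos hω hm0)
    rw [log_div hω.ne' hm0.ne'] at h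
    have heq : (1 + X ω) / (1 + m) - 1 = (X ω - m) / (1 + m) := by field_simp; ring
    linarith
  have hsub : Integrable (fun ω => X ω - m) μ := hX_int.sub (integrable_const m)
  calc ∫ ω, log (1 + X ω) ∂μ
      ≤ ∫ ω, (log (1 + m) + (X ω - m) / (1 + m)) ∂μ :=
        integral_mono (integrable_log_one_add hX hX_int)
          ((integrable_const _).add (hsub.div_const _)) htangent
    _ = log (1 + m) := by
        rw [integral_add (integrable_const _) (hsub.div_const _), integral_div,
          integral_sub hX_int (integrable_const m), ← hm]
        simp

/-- Mean ASE, super-linear case (core of Lemma 5 / Theorem 2 for the mean):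
if `a_n → ∞`, `Z_n → K` a.s. and `E[Z_n] → K`, then
`E[log₂(1 + a_n · Z_n)] / log₂(a_n) → 1`. -/
theorem mean_ase_superlinear
    {Ω : Type*} [MeasurableSpace Ω] {μ : Measure Ω} [IsProbabilityMeasure μ]
    (K : ℝ) (hK : 0 < K)
    (a : ℕ → ℝ) (ha_pos : ∀ n, 0 < a n) (ha : Tendsto a atTop atTop)
    (Z : ℕ → Ω → ℝ) (hZ_nonneg : ∀ n ω, 0 ≤ Z n ω)
    (hZ_int : ∀ n, Integrable (Z n) μ)
    (hZ_as : ∀ᵐ ω ∂μ, Tendsto (fun n => Z n ω) atTop (nhds K))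
    (hZ_mean : Tendsto (fun n => ∫ ω, Z n ω ∂μ) atTop (nhds K)) :
    Tendsto (fun n => (∫ ω, logb 2 (1 + a n * Z n ω) ∂μ) / logb 2 (a n)) atTop
      (nhds 1) := by
  have hratio : ∀ n, (∫ ω, logb 2 (1 + a n * Z n ω) ∂μ) / logb 2 (a n) =
      ∫ ω, log (1 + a n * Z n ω) / log (a n) ∂μ := fun n => by
    simp only [logb, integral_div]
    exact div_div_div_cancel_right₀ (log_pos one_lt_two).ne' _ _
  simp_rw [hratio]
  have hX : ∀ n ω, 0 ≤ a n * Z n ω := fun n ω => mul_nonneg (ha_pos n).le (hZ_nonneg n ω)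
  have hX_int : ∀ n, Integrable (fun ω => a n * Z n ω) μ := fun n => (hZ_int n).const_mul _
  have hf_int : ∀ n, Integrable (fun ω => log (1 + a n * Z n ω) / log (a n)) μ := fun n =>
    (integrable_log_one_add (hX n) (hX_int n)).div_const _
  have hf_nonneg : ∀ n, 1 < a n → ∀ ω, 0 ≤ log (1 + a n * Z n ω) / log (a n) :=
    fun n hn ω => div_nonneg (log_nonneg (by linarith [hX n ω])) (log_pos hn).le
  have hlower : Tendsto (fun n => ∫ ω, min (log (1 + a n * Z n ω) / log (a n)) 1 ∂μ) atTop
      (nhds 1) := by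
    have h := tendsto_integral_filter_of_dominated_convergence (μ := μ) (l := atTop)
      (F := fun n ω => min (log (1 + a n * Z n ω) / log (a n)) 1) (f := fun _ => 1)
      (fun _ => 1)
      (Eventually.of_forall fun n => ((hf_int n).inf (integrable_const 1)).aestronglyMeasurable)
      ?_ (integrable_const 1) ?_
    · simpa using h
    · filter_upwards [ha.eventually_gt_atTop 1] with n hn
      refine Eventually.of_forall fun ω => ?_
      rw [norm_eq_abs, abs_of_nonneg (le_min (hf_nonneg n hn ω) zero_le_one)]
      exact min_le_right _ _
    · filter_upwards [hZ_as] with ω hω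
      simpa using (tendsto_log_one_add_mul_div_log hK ha hω).min (tendsto_const_nhds (x := (1 : ℝ)))
  refine tendsto_of_tendsto_of_tendsto_of_le_of_le' hlower
    (tendsto_log_one_add_mul_div_log hK ha hZ_mean) ?_ ?_
  · exact Eventually.of_forall fun n =>
      integral_mono ((hf_int n).inf (integrable_const 1)) (hf_int n) fun ω => min_le_left _ _
  · filter_upwards [ha.eventually_gt_atTop 1] with n hn
    rw [integral_div, ← integral_const_mul]
    exact div_le_div_of_nonneg_right (integral_log_one_add_le (hX n) (hX_int n)) (log_pos hn).le
end
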